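/- Let d, n be natural numbers with 1 ≤ n ≤ d and let M₀ > 0. For each j = 1, …, d let f_j : ℂ → [0,∞) be a probability density function with respect to Lebesgue measure on ℂ ≅ ℝ², satisfying sup_{z ∈ ℂ} f_j(z) ≤ M₀. Let f(z₁,…,z_d) = ∏_{j=1}^d f_j(z_j) be the product density on ℂ^d. Let V ⊆ ℂ^d be a complex linear subspace of dimension n and V^⊥ its orthogonal complement with respect to the standard Hermitian inner product, and for v₀ ∈ V define g_V(v₀) = ∫_{V^⊥} f(v₀ + v₁) dV₁(v₁), where dV₁ is Lebesgue measure on V^⊥. Then g_V is a probability density function on V (with respect to Lebesgue measure on V), and sup_{v₀ ∈ V} g_V(v₀) ≤ M₀^n · C(d,n), where C(d,n) = d!/(n!(d−n)!) is the binomial coefficient. -/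

import Mathlib

open MeasureTheory

/- Borel measurable structure on `ℂ^d` (with the standard Hermitian inner product)
and on its complex subspaces. -/
noncomputable instance (d : ℕ) : MeasurableSpace (EuclideanSpace ℂ (Fin d)) := borel _
instance (d : ℕ) : BorelSpace (EuclideanSpace ℂ (Fin d)) := ⟨rfl⟩
noncomputable instance (d : ℕ) (V : Submodule ℂ (EuclideanSpace ℂ (Fin d))) :
    MeasurableSpace V := borel _
instance (d : ℕ) (V : Submodule ℂ (EuclideanSpace ℂ (Fin d))) : BorelSpace V := ⟨rfl⟩
/- The real inner product structure underlying the Hermitian one; this induces (via the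
canonical Haar measure of a finite-dimensional real inner product space) the correctly
normalized Lebesgue measure (`volume`) on a complex subspace `V` of `ℂ^d` and on `Vᗮ`,
so that orthogonal products of these measures recover Lebesgue measure on `ℂ^d`. -/
noncomputable instance (d : ℕ) (V : Submodule ℂ (EuclideanSpace ℂ (Fin d))) :
    InnerProductSpace ℝ V := InnerProductSpace.complexToReal

open Module in
/-- Cauchy–Binet for an orthonormal family: the squared moduli of its maximal minors
add up to one, so one of them is at least the average. -/
theorem Orthonormal.exists_one_le_choose_mul_normSq_minor {d k : ℕ}
    {v : Fin k → EuclideanSpace ℂ (Fin d)} (hv : Orthonormal ℂ v) :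
    ∃ s : Fin k ↪o Fin d,
      1 ≤ (d.choose k : ℝ) * Complex.normSq (Matrix.of fun i j => v j (s i)).det := by
  classical
  let b := (EuclideanSpace.basisFun (Fin d) ℂ).toBasis
  let x := exteriorPower.ιMulti ℂ k v
  let φ := exteriorPower.pairingDual ℂ (EuclideanSpace ℂ (Fin d)) k
    (exteriorPower.ιMulti ℂ k fun i => (innerSL ℂ (v i)).toLinearMap)
  let m : Set.powersetCard (Fin d) k → ℂ := fun s =>
    (Matrix.of fun i j => v j (Set.powersetCard.ofFinEmbEquiv.symm s i)).det
  have hφx : φ x = 1 := by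
    simp only [φ, x, exteriorPower.pairingDual_ιMulti_ιMulti]
    rw [← Matrix.det_one (n := Fin k)]
    congr 1
    ext i j
    simp [orthonormal_iff_ite.mp hv, Matrix.one_apply, eq_comm]
  have hrepr : ∀ s, (b.exteriorPower k).repr x s = m s := by
    intro s
    rw [exteriorPower.basis_repr_apply, exteriorPower.ιMultiDual_apply_ιMulti,
      ← Matrix.det_transpose]
    congr 1
  have hφb : ∀ s, φ (b.exteriorPower k s) = (starRingEnd ℂ) (m s) := by
    intro s
    rw [exteriorPower.basis_apply, exteriorPower.ιMulti_family,
      exteriorPower.pairingDual_ιMulti_ιMulti, RingHom.map_det]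
    congr 1
    ext i j
    simp [b, EuclideanSpace.inner_single_right]
  have hsum : ∑ s, Complex.normSq (m s) = 1 := by
    have h : φ x = ∑ s, ((Complex.normSq (m s) : ℝ) : ℂ) := by
      conv_lhs => rw [← (b.exteriorPower k).sum_repr x]
      simp only [map_sum, map_smul, hrepr, hφb, smul_eq_mul, Complex.mul_conj]
    rw [hφx] at h
    exact_mod_cast h.symm
  by_contra! hlt
  have hcard : (Finset.univ : Finset (Set.powersetCard (Fin d) k)).card = d.choose k := by
    rw [Finset.card_univ, Fintype.card_eq_nat_card, Set.powersetCard.card, Nat.card_fin]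
  have hne : (Finset.univ : Finset (Set.powersetCard (Fin d) k)).Nonempty := by
    by_contra h
    rw [Finset.not_nonempty_iff_eq_empty] at h
    simp [h] at hsum
  have := Finset.sum_lt_sum_of_nonempty hne
    (fun s _ => hlt (Set.powersetCard.ofFinEmbEquiv.symm s))
  rw [← Finset.mul_sum] at this
  change (d.choose k : ℝ) * ∑ s, Complex.normSq (m s) < _ at this
  simp [hsum, hcard] at this

/-- A topological isomorphism between additive groups preserves Haar measures as soon as it
preserves one non-zero integral. -/
theorem AddEquiv.measurePreserving_of_integral_eq {X Y : Type*}
    [AddGroup X] [TopologicalSpace X] [IsTopologicalAddGroup X] [MeasurableSpace X] [BorelSpace X]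
    [AddGroup Y] [TopologicalSpace Y] [IsTopologicalAddGroup Y] [MeasurableSpace Y] [BorelSpace Y]
    [LocallyCompactSpace Y] [SecondCountableTopology Y]
    (μ : Measure X) [μ.IsAddHaarMeasure] (ν : Measure Y) [ν.IsAddHaarMeasure]
    (e : X ≃+ Y) (he : Continuous e) (he' : Continuous e.symm) (φ : Y → ℝ)
    (h : ∫ x, φ (e x) ∂μ = ∫ y, φ y ∂ν) (h0 : ∫ y, φ y ∂ν ≠ 0) :
    MeasurePreserving e μ ν := by
  refine ⟨he.measurable, ?_⟩
  have : (μ.map e).IsAddHaarMeasure := e.isAddHaarMeasure_map μ he he'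
  have hc := Measure.isAddLeftInvariant_eq_smul (μ.map e) ν
  have hemb : MeasurableEmbedding e :=
    (Homeomorph.mk e.toEquiv he he').measurableEmbedding
  rw [← hemb.integral_map, hc, integral_smul_nnreal_measure] at h
  have : Measure.addHaarScalarFactor (μ.map e) ν = 1 := by
    have h1 := mul_right_cancel₀ h0 (h.trans (one_mul _).symm)
    exact_mod_cast h1
  rw [hc, this, one_smul]

theorem integral_pi_complex_gaussian (k : ℕ) :
    ∫ z : Fin k → ℂ, Real.exp (-∑ i, ‖z i‖ ^ 2) = Real.pi ^ k := by
  have h : ∫ z : ℂ, Real.exp (-‖z‖ ^ 2) = Real.pi := by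
    have := GaussianFourier.integral_rexp_neg_mul_sq_norm (V := ℂ) one_pos
    simpa [Complex.finrank_real_complex] using this
  simp_rw [← Finset.sum_neg_distrib, Real.exp_sum]
  rw [integral_fintype_prod_volume_eq_prod (f := fun _ (z : ℂ) => Real.exp (-‖z‖ ^ 2))]
  simp [h]

theorem Submodule.integral_gaussian {d : ℕ} (V : Submodule ℂ (EuclideanSpace ℂ (Fin d))) :
    ∫ v : V, Real.exp (-‖v‖ ^ 2) = Real.pi ^ Module.finrank ℂ V := by
  have := GaussianFourier.integral_rexp_neg_mul_sq_norm (V := V) one_pos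
  have hr : Module.finrank ℝ V = 2 * Module.finrank ℂ V := finrank_real_of_complex V
  simpa [hr] using this

/-- Unitary coordinates on a complex subspace preserve Lebesgue measure. -/
theorem OrthonormalBasis.measurePreserving_sum_smul {d k : ℕ}
    {V : Submodule ℂ (EuclideanSpace ℂ (Fin d))} (b : OrthonormalBasis (Fin k) ℂ V) :
    MeasurePreserving (fun z : Fin k → ℂ => ∑ i, z i • b i) := by
  let e : (Fin k → ℂ) ≃ₗ[ℂ] V :=
    (WithLp.linearEquiv 2 ℂ (Fin k → ℂ)).symm.trans b.repr.symm.toLinearEquiv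
  have he : ∀ z, e z = ∑ i, z i • b i := fun z => by
    simp [e, ← b.sum_repr_symm]
  have hnorm : ∀ z, ‖e z‖ ^ 2 = ∑ i, ‖z i‖ ^ 2 := fun z => by
    simp [e, EuclideanSpace.norm_sq_eq]
  have hk : Module.finrank ℂ V = k := by
    simpa using Module.finrank_eq_card_basis b.toBasis
  have hV := V.integral_gaussian
  have := AddEquiv.measurePreserving_of_integral_eq volume volume e.toAddEquiv
    e.toLinearMap.continuous_of_finiteDimensional
    e.symm.toLinearMap.continuous_of_finiteDimensional (fun v => Real.exp (-‖v‖ ^ 2))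
    (by
      rw [hV, hk, ← integral_pi_complex_gaussian]
      congr 1
      ext z
      exact congrArg (fun t => Real.exp (-t)) (hnorm z))
    (by rw [hV]; positivity)
  convert! this using 1
  ext1 z
  exact (he z).symm

/-- The orthogonal product of the Lebesgue measures on `V` and `Vᗮ` is Lebesgue measure. -/
theorem Submodule.measurePreserving_add_orthogonal {d : ℕ}
    (V : Submodule ℂ (EuclideanSpace ℂ (Fin d))) :
    MeasurePreserving
      (fun (p : V × Vᗮ) (j : Fin d) =>
        ((p.1 : EuclideanSpace ℂ (Fin d)) + (p.2 : EuclideanSpace ℂ (Fin d))) j)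
      (volume.prod volume) volume := by
  let e : (V × Vᗮ) ≃ₗ[ℂ] (Fin d → ℂ) :=
    (Submodule.prodEquivOfIsCompl V Vᗮ V.isCompl_orthogonal).trans
      (WithLp.linearEquiv 2 ℂ (Fin d → ℂ))
  have hnorm : ∀ p, ∑ i, ‖e p i‖ ^ 2 = ‖p.1‖ ^ 2 + ‖p.2‖ ^ 2 := fun p => by
    have h := norm_add_sq_eq_norm_sq_add_norm_sq_of_inner_eq_zero
      (p.1 : EuclideanSpace ℂ (Fin d)) (p.2 : EuclideanSpace ℂ (Fin d))
      (Submodule.inner_right_of_mem_orthogonal p.1.2 p.2.2)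
    simp only [← sq] at h
    rw [EuclideanSpace.norm_sq_eq] at h
    exact h
  have hfin := V.finrank_add_finrank_orthogonal
  rw [finrank_euclideanSpace_fin] at hfin
  have := Measure.prod.instIsAddHaarMeasure (volume : Measure V) (volume : Measure Vᗮ)
  have := AddEquiv.measurePreserving_of_integral_eq ((volume : Measure V).prod volume) volume
    e.toAddEquiv e.toLinearMap.continuous_of_finiteDimensional
    e.symm.toLinearMap.continuous_of_finiteDimensional
    (fun z => Real.exp (-∑ i, ‖z i‖ ^ 2))
    (by
      rw [integral_pi_complex_gaussian, congrArg (Real.pi ^ ·) hfin.symm, pow_add, ← V.integral_gaussian,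
        ← Vᗮ.integral_gaussian, ← integral_prod_mul]
      congr 1
      ext p
      rw [← Real.exp_add, ← neg_add, ← hnorm]
      rfl)
    (by rw [integral_pi_complex_gaussian]; positivity)
  exact this

theorem Matrix.map_mulVec_volume_complex {k : ℕ} {A : Matrix (Fin k) (Fin k) ℂ}
    (hA : A.det ≠ 0) :
    (volume : Measure (Fin k → ℂ)).map A.mulVec =
      ENNReal.ofReal (Complex.normSq A.det)⁻¹ • volume := by
  have hdet : LinearMap.det ((Matrix.toLin' A).restrictScalars ℝ) = Complex.normSq A.det := by
    rw [LinearMap.det_restrictScalars, LinearMap.det_toLin', Algebra.norm_complex_apply]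
  have := Measure.map_linearMap_addHaar_eq_smul_addHaar (volume : Measure (Fin k → ℂ))
    (f := (Matrix.toLin' A).restrictScalars ℝ) (by rw [hdet]; simpa using hA)
  rw [hdet, abs_of_nonneg (inv_nonneg.mpr (Complex.normSq_nonneg _))] at this
  exact this

/-- Marginal densities of a product density with uniformly bounded factors:
if each factor density `f j` is bounded by `M₀` and `V ⊆ ℂ^d` is a complex subspace of
dimension `n`, then the marginal `g_V(v₀) = ∫_{V^⊥} f(v₀ + v₁) dv₁` is a probability density
on `V` bounded by `M₀ ^ n * (d choose n)`. -/
theorem marginal_density_bound (d n : ℕ) (hn : 1 ≤ n) (hnd : n ≤ d)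
    (M₀ : ℝ) (hM₀ : 0 < M₀) (f : Fin d → ℂ → ℝ)
    (hf_meas : ∀ j, Measurable (f j))
    (hf_nonneg : ∀ j z, 0 ≤ f j z)
    (hf_prob : ∀ j, ∫ z : ℂ, f j z = 1)
    (hf_bdd : ∀ j z, f j z ≤ M₀)
    (V : Submodule ℂ (EuclideanSpace ℂ (Fin d))) (hV : Module.finrank ℂ V = n) :
    let F : EuclideanSpace ℂ (Fin d) → ℝ := fun z => ∏ j, f j (z j)
    let g : V → ℝ := fun v₀ =>
      ∫ v₁ : Vᗮ, F ((v₀ : EuclideanSpace ℂ (Fin d)) + (v₁ : EuclideanSpace ℂ (Fin d)))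
    Measurable g ∧ (∀ v₀ : V, 0 ≤ g v₀) ∧ (∫ v₀ : V, g v₀ = 1) ∧
      (∀ v₀ : V, g v₀ ≤ M₀ ^ n * (d.choose n)) := by
  intro F g
  have hint : ∀ j, Integrable (f j) := fun j =>
    Integrable.of_integral_ne_zero (by rw [hf_prob j]; exact one_ne_zero)
  have hF_nonneg : ∀ z, 0 ≤ F z := fun z => Finset.prod_nonneg fun j _ => hf_nonneg j _
  have hΦ := V.measurePreserving_add_orthogonal
  have hG_int : Integrable (fun z : Fin d → ℂ => ∏ j, f j (z j)) := Integrable.fintype_prod hint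
  have hG_meas : Measurable (fun z : Fin d → ℂ => ∏ j, f j (z j)) :=
    Finset.measurable_fun_prod _ fun j _ => (hf_meas j).comp (measurable_pi_apply j)
  have hFadd_meas : Measurable (fun p : V × Vᗮ =>
      F ((p.1 : EuclideanSpace ℂ (Fin d)) + (p.2 : EuclideanSpace ℂ (Fin d)))) :=
    hG_meas.comp hΦ.measurable
  refine ⟨?_, fun v₀ => integral_nonneg fun _ => hF_nonneg _, ?_, fun v₀ => ?_⟩
  · exact hFadd_meas.stronglyMeasurable.integral_prod_right.measurable
  · have hFadd_int : Integrable (fun p : V × Vᗮ =>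
        F ((p.1 : EuclideanSpace ℂ (Fin d)) + (p.2 : EuclideanSpace ℂ (Fin d))))
        (volume.prod volume) := hΦ.integrable_comp_of_integrable hG_int
    rw [← integral_prod _ hFadd_int]
    have h := integral_map (μ := (volume : Measure V).prod volume) hΦ.measurable.aemeasurable
      (f := fun z : Fin d → ℂ => ∏ j, f j (z j)) hG_meas.aestronglyMeasurable
    rw [hΦ.map_eq, integral_fintype_prod_volume_eq_prod] at h
    simpa [F, hf_prob] using h.symm
  obtain ⟨k, hk⟩ : ∃ k, Module.finrank ℂ Vᗮ = k := ⟨_, rfl⟩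
  have hnk : n + k = d := by
    have h := V.finrank_add_finrank_orthogonal
    rwa [hV, hk, finrank_euclideanSpace_fin] at h
  let b : OrthonormalBasis (Fin k) ℂ Vᗮ := (stdOrthonormalBasis ℂ Vᗮ).reindex (finCongr hk)
  obtain ⟨s, hs⟩ := (b.orthonormal.comp_linearIsometry Vᗮ.subtypeₗᵢ)
    |>.exists_one_le_choose_mul_normSq_minor
  set A : Matrix (Fin k) (Fin k) ℂ :=
    Matrix.of fun i j => (Vᗮ.subtypeₗᵢ ∘ b) j (s i)
  have hA : A.det ≠ 0 := fun h => by
    rw [h] at hs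
    norm_num at hs
  -- the dominating function only retains the coordinates selected by `s`
  let H : (Fin k → ℂ) → ℝ := fun z => ∏ i, f (s i) ((v₀ : EuclideanSpace ℂ (Fin d)) (s i) + z i)
  have hH_int : Integrable H := Integrable.fintype_prod fun i => (hint (s i)).comp_add_left _
  have hH_meas : Measurable H := Finset.measurable_fun_prod _ fun i _ =>
    (hf_meas (s i)).comp ((measurable_pi_apply i).const_add _)
  have hH_one : ∫ z, H z = 1 := by
    rw [integral_fintype_prod_volume_eq_prod (f := fun i (z : ℂ) =>
      f (s i) ((v₀ : EuclideanSpace ℂ (Fin d)) (s i) + z))]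
    refine Finset.prod_eq_one fun i _ => ?_
    rw [integral_add_left_eq_self, hf_prob]
  have hF_le : ∀ z : Fin k → ℂ,
      F (v₀ + ((∑ i, z i • b i : Vᗮ) : EuclideanSpace ℂ (Fin d))) ≤ M₀ ^ n * H (A.mulVec z) := by
    intro z
    have hcoord : ∀ i, ((∑ i, z i • b i : Vᗮ) : EuclideanSpace ℂ (Fin d)) (s i) =
        A.mulVec z i := fun i => by
      simp [A, Matrix.mulVec, dotProduct, mul_comm]
    have hcard : (Finset.univ.map s.toEmbedding)ᶜ.card = n := by
      rw [Finset.card_compl, Finset.card_map]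
      simp
      omega
    rw [← hcard, ← Finset.prod_const]
    simp only [F, H]
    rw [← Finset.prod_compl_mul_prod (Finset.univ.map s.toEmbedding), Finset.prod_map]
    refine mul_le_mul (Finset.prod_le_prod (fun j _ => hf_nonneg j _) fun j _ => hf_bdd j _)
      (le_of_eq ?_) (Finset.prod_nonneg fun j _ => hf_nonneg _ _)
      (Finset.prod_nonneg fun _ _ => hM₀.le)
    refine Finset.prod_congr rfl fun i _ => ?_
    rw [← hcoord]
    rfl
  have hb := b.measurePreserving_sum_smul
  have hAmeas : Measurable A.mulVec :=
    (Continuous.matrix_mulVec continuous_const continuous_id).measurable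
  have hmap := Matrix.map_mulVec_volume_complex hA
  have hHA_int : Integrable (fun z => H (A.mulVec z)) := by
    have : Integrable H (volume.map A.mulVec) := by
      rw [hmap]
      exact hH_int.smul_measure ENNReal.ofReal_ne_top
    exact this.comp_measurable hAmeas
  have hHA : ∫ z, H (A.mulVec z) = (Complex.normSq A.det)⁻¹ := by
    rw [← integral_map hAmeas.aemeasurable hH_meas.aestronglyMeasurable, hmap,
      integral_smul_measure, hH_one,
      ENNReal.toReal_ofReal (inv_nonneg.mpr (Complex.normSq_nonneg _))]
    simp
  calc g v₀ = ∫ z : Fin k → ℂ, F (v₀ + ((∑ i, z i • b i : Vᗮ) : EuclideanSpace ℂ (Fin d))) := by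
        have hmeas : Measurable fun v₁ : Vᗮ =>
            F ((v₀ : EuclideanSpace ℂ (Fin d)) + (v₁ : EuclideanSpace ℂ (Fin d))) :=
          hFadd_meas.comp measurable_prodMk_left
        rw [← integral_map hb.measurable.aemeasurable
          (f := fun v₁ : Vᗮ => F ((v₀ : EuclideanSpace ℂ (Fin d)) + v₁))
          hmeas.aestronglyMeasurable, hb.map_eq]
    _ ≤ ∫ z, M₀ ^ n * H (A.mulVec z) :=
        integral_mono_of_nonneg (.of_forall fun _ => hF_nonneg _) (hHA_int.const_mul _)
          (.of_forall hF_le)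
    _ = M₀ ^ n * (Complex.normSq A.det)⁻¹ := by rw [integral_const_mul, hHA]
    _ ≤ M₀ ^ n * d.choose n := by
        have hsym : d.choose k = d.choose n := by
          rw [← hnk, Nat.choose_symm_add]
        rw [hsym] at hs
        gcongr
        rwa [inv_le_iff_one_le_mul₀ (Complex.normSq_pos.mpr hA)]
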